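/- For any object A of C, Q(A) is a zero object of D if and only if A belongs to N. -/

import Mathlib

open CategoryTheory CategoryTheory.Limits CategoryTheory.Pretriangulated

universe v u v₂ u₂

variable {C : Type u} [Category.{v} C] [Preadditive C] [HasZeroObject C]
  [HasShift C ℤ] [∀ n : ℤ, (shiftFunctor C n).Additive] [Pretriangulated C]

/-- `f : X ⟶ Y` factors through an object of `N`. -/
def FactorsThru (N : Set C) {X Y : C} (f : X ⟶ Y) : Prop :=
  ∃ (Z : C) (_ : Z ∈ N) (u : X ⟶ Z) (v : Z ⟶ Y), f = u ≫ v

/-- The morphism `X⟦-1⟧ ⟶ A` obtained from `h : X ⟶ A⟦1⟧` by shifting by `-1` and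
composing with the canonical isomorphism `A⟦1⟧⟦-1⟧ ≅ A`. -/
noncomputable def descShift {X A : C} (h : X ⟶ A⟦(1:ℤ)⟧) : X⟦(-1:ℤ)⟧ ⟶ A :=
  h⟦(-1:ℤ)⟧' ≫ (shiftEquiv C (1:ℤ)).unitIso.inv.app A

/-- The class `S_N` of morphisms fitting in a distinguished triangle whose two other
maps factor through `N`. -/
def SN (N : Set C) {B C₀ : C} (g : B ⟶ C₀) : Prop :=
  ∃ (A : C) (f : A ⟶ B) (h : C₀ ⟶ A⟦(1:ℤ)⟧),
    (Triangle.mk f g h ∈ distTriang C) ∧ FactorsThru N f ∧ FactorsThru N h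

/-- The class `L`. -/
def ClassL (N : Set C) {A B : C} (f : A ⟶ B) : Prop :=
  ∃ (N₀ : C) (_ : N₀ ∈ N) (g : B ⟶ N₀) (h : N₀ ⟶ A⟦(1:ℤ)⟧),
    (Triangle.mk f g h ∈ distTriang C) ∧ FactorsThru N (descShift h)

/-- The class `R`. -/
def ClassR (N : Set C) {B C₀ : C} (g : B ⟶ C₀) : Prop :=
  ∃ (N₀ : C) (_ : N₀ ∈ N) (f : N₀ ⟶ B) (h : C₀ ⟶ N₀⟦(1:ℤ)⟧),
    (Triangle.mk f g h ∈ distTriang C) ∧ FactorsThru N h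

/-- Condition (Lex) on a morphism `h : C₀ ⟶ A⟦1⟧`. -/
def LexCond (N : Set C) {C₀ A : C} (h : C₀ ⟶ A⟦(1:ℤ)⟧) : Prop :=
  ∀ (N₀ : C), N₀ ∈ N → ∀ (x : N₀ ⟶ C₀), FactorsThru N (descShift (x ≫ h))

/-- Condition (Rex) on a morphism `h : C₀ ⟶ A⟦1⟧`. -/
def RexCond (N : Set C) {C₀ A : C} (h : C₀ ⟶ A⟦(1:ℤ)⟧) : Prop :=
  ∀ (N₀ : C), N₀ ∈ N → ∀ (y : A ⟶ N₀),
    ∃ (M : C) (_ : M ∈ N) (u : C₀⟦(-1:ℤ)⟧ ⟶ M⟦(-1:ℤ)⟧) (v : M⟦(-1:ℤ)⟧ ⟶ N₀),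
      descShift h ≫ y = u ≫ v

/-- `S_N` as a morphism property. -/
def SNProp (N : Set C) : MorphismProperty C := fun _ _ g => SN N g

lemma CategoryTheory.Pretriangulated.exists_extension (T : Triangle C) (hT : T ∈ distTriang C)
    {X : C} (y : T.obj₁ ⟶ X) (hy : T.mor₃ ≫ y⟦(1 : ℤ)⟧' = 0) :
    ∃ e : T.obj₂ ⟶ X, T.mor₁ ≫ e = y := by
  obtain ⟨e, he, -⟩ := complete_distinguished_triangle_morphism₂ T _ hT
    (contractible_distinguished X) y 0 (hy.trans zero_comp.symm)
  exact ⟨e, he.trans (Category.comp_id y)⟩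

namespace FactorsThru

set_option linter.unusedSectionVars false

variable {N : Set C} {X Y Z : C}

lemma precomp {g : Y ⟶ Z} (hg : FactorsThru N g) (f : X ⟶ Y) : FactorsThru N (f ≫ g) := by
  obtain ⟨M, hM, a, b, rfl⟩ := hg
  exact ⟨M, hM, f ≫ a, b, by simp⟩

lemma postcomp {f : X ⟶ Y} (hf : FactorsThru N f) (g : Y ⟶ Z) : FactorsThru N (f ≫ g) := by
  obtain ⟨M, hM, a, b, rfl⟩ := hf
  exact ⟨M, hM, a, b ≫ g, by simp⟩

lemma neg {f : X ⟶ Y} (hf : FactorsThru N f) : FactorsThru N (-f) := by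
  obtain ⟨M, hM, a, b, rfl⟩ := hf
  exact ⟨M, hM, -a, b, by simp⟩

lemma add (hNext : ∀ (T : Triangle C), (T ∈ distTriang C) → T.obj₁ ∈ N → T.obj₃ ∈ N → T.obj₂ ∈ N)
    {f g : X ⟶ Y} (hf : FactorsThru N f) (hg : FactorsThru N g) : FactorsThru N (f + g) := by
  obtain ⟨M, hM, a, b, rfl⟩ := hf
  obtain ⟨M', hM', a', b', rfl⟩ := hg
  exact ⟨M ⊞ M', hNext _ (binaryBiproductTriangle_distinguished M M') hM hM',
    biprod.lift a a', biprod.desc b b', by simp⟩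

lemma of_mem (hX : X ∈ N) (f : X ⟶ Y) : FactorsThru N f := ⟨X, hX, 𝟙 X, f, by simp⟩

lemma of_mem_tgt (hY : Y ∈ N) (f : X ⟶ Y) : FactorsThru N f := ⟨Y, hY, f, 𝟙 Y, by simp⟩

lemma zero (hN0 : ∀ X : C, Limits.IsZero X → X ∈ N) : FactorsThru N (0 : X ⟶ Y) :=
  ⟨_, hN0 _ (isZero_zero C), 0, 0, by simp⟩

end FactorsThru

namespace SN

variable {N : Set C}

/-- Morphisms in `S_N` can be cancelled on the right modulo the ideal of morphisms that
factor through `N`. -/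
lemma factorsThru_of_comp_right
    (hNext : ∀ (T : Triangle C), (T ∈ distTriang C) → T.obj₁ ∈ N → T.obj₃ ∈ N → T.obj₂ ∈ N)
    {X B C₀ : C} {s : B ⟶ C₀} (hs : SN N s) {x : X ⟶ B}
    (hx : FactorsThru N (x ≫ s)) : FactorsThru N x := by
  obtain ⟨A, f, h, hT, ⟨N₁, hN₁, f₁, f₂, hf⟩, -⟩ := hs
  obtain ⟨M, hM, m, c, hmc⟩ := hx
  have hsh : s ≫ h = 0 := comp_distTriang_mor_zero₂₃ _ hT
  have hhf : h ≫ f⟦(1 : ℤ)⟧' = 0 := comp_distTriang_mor_zero₃₁ _ hT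
  obtain ⟨P, a, p, hP⟩ := distinguished_cocone_triangle₂ (c ≫ h)
  obtain ⟨b, hab, hpb⟩ : ∃ b : P ⟶ B, a ≫ b = 𝟙 A ≫ f ∧ p ≫ c = b ≫ s :=
    complete_distinguished_triangle_morphism₂ _ _ hP hT (𝟙 A) c (by
      change (c ≫ h) ≫ (𝟙 A)⟦(1 : ℤ)⟧' = c ≫ h
      rw [CategoryTheory.Functor.map_id, Category.comp_id])
  obtain ⟨l, hl⟩ : ∃ l : X ⟶ P, m = l ≫ p := Triangle.coyoneda_exact₃ _ hP m (by
    change m ≫ c ≫ h = 0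
    rw [← Category.assoc, ← hmc, Category.assoc, hsh, comp_zero])
  obtain ⟨t, ht⟩ : ∃ t : X ⟶ A, x - l ≫ b = t ≫ f := Triangle.coyoneda_exact₂ _ hT _ (by
    change (x - l ≫ b) ≫ s = 0
    rw [Preadditive.sub_comp, Category.assoc, ← hpb, hmc, hl, Category.assoc, sub_self])
  obtain ⟨P', n, p', hP'⟩ := distinguished_cocone_triangle₂ ((c ≫ h) ≫ f₁⟦(1 : ℤ)⟧')
  obtain ⟨π, hπ, hπ'⟩ : ∃ π : P ⟶ P', a ≫ π = f₁ ≫ n ∧ p ≫ 𝟙 M = π ≫ p' :=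
    complete_distinguished_triangle_morphism₂ _ _ hP hP' f₁ (𝟙 M) (Category.id_comp _).symm
  obtain ⟨e, he⟩ : ∃ e : P' ⟶ B, n ≫ e = f₂ := exists_extension _ hP' f₂ (by
    change ((c ≫ h) ≫ f₁⟦(1 : ℤ)⟧') ≫ f₂⟦(1 : ℤ)⟧' = 0
    rw [Category.assoc, ← Functor.map_comp, ← hf, Category.assoc, hhf, comp_zero])
  obtain ⟨w, hw⟩ : ∃ w : M ⟶ B, b - π ≫ e = p ≫ w := Triangle.yoneda_exact₂ _ hP _ (by
    change a ≫ (b - π ≫ e) = 0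
    rw [Preadditive.comp_sub, ← Category.assoc, hπ, Category.assoc, he, hab, Category.id_comp,
      hf, sub_self])
  have hb : FactorsThru N b := by
    rw [sub_eq_iff_eq_add.1 hw]
    exact ((FactorsThru.of_mem hM w).precomp p).add hNext
      ((FactorsThru.of_mem (hNext _ hP' hN₁ hM) e).precomp π)
  rw [sub_eq_iff_eq_add.1 ht]
  exact (FactorsThru.precomp ⟨N₁, hN₁, f₁, f₂, hf⟩ t).add hNext (hb.precomp l)

/-- Morphisms in `S_N` can be cancelled on the left modulo the ideal of morphisms that
factor through `N`. -/
lemma factorsThru_of_comp_left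
    (hNext : ∀ (T : Triangle C), (T ∈ distTriang C) → T.obj₁ ∈ N → T.obj₃ ∈ N → T.obj₂ ∈ N)
    {B C₀ Y : C} {s : B ⟶ C₀} (hs : SN N s) {y : C₀ ⟶ Y}
    (hy : FactorsThru N (s ≫ y)) : FactorsThru N y := by
  obtain ⟨A, f, h, hT, -, ⟨N₂, hN₂, h₁, h₂, hh⟩⟩ := hs
  obtain ⟨M, hM, p, q, hpq⟩ := hy
  have hfs : f ≫ s = 0 := comp_distTriang_mor_zero₁₂ _ hT
  have hhf : h ≫ f⟦(1 : ℤ)⟧' = 0 := comp_distTriang_mor_zero₃₁ _ hT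
  obtain ⟨P, m, k, hP⟩ := distinguished_cocone_triangle (f ≫ p)
  obtain ⟨c, hc, hck⟩ : ∃ c : C₀ ⟶ P, s ≫ c = p ≫ m ∧ h ≫ (𝟙 A)⟦(1 : ℤ)⟧' = c ≫ k :=
    complete_distinguished_triangle_morphism _ _ hT hP (𝟙 A) p (Category.id_comp _).symm
  obtain ⟨l, hl⟩ : ∃ l : P ⟶ Y, q = m ≫ l := Triangle.yoneda_exact₂ _ hP q (by
    change (f ≫ p) ≫ q = 0
    rw [Category.assoc, ← hpq, ← Category.assoc, hfs, zero_comp])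
  obtain ⟨t, ht⟩ : ∃ t : A⟦(1 : ℤ)⟧ ⟶ Y, y - c ≫ l = h ≫ t := Triangle.yoneda_exact₃ _ hT _ (by
    change s ≫ (y - c ≫ l) = 0
    rw [Preadditive.comp_sub, ← Category.assoc, hc, hpq, hl, Category.assoc, sub_self])
  obtain ⟨P', n, p', hP'⟩ := distinguished_cocone_triangle₂ (h₂ ≫ (-(f ≫ p)⟦(1 : ℤ)⟧'))
  obtain ⟨π, hπ, hπ'⟩ : ∃ π : P' ⟶ P, n ≫ π = 𝟙 M ≫ m ∧ p' ≫ h₂ = π ≫ k :=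
    complete_distinguished_triangle_morphism₂ _ _ hP' (rot_of_distTriang _ hP) (𝟙 M) h₂
      (by
        change (h₂ ≫ (-(f ≫ p)⟦(1 : ℤ)⟧')) ≫ (𝟙 M)⟦(1 : ℤ)⟧' = h₂ ≫ (-(f ≫ p)⟦(1 : ℤ)⟧')
        rw [CategoryTheory.Functor.map_id, Category.comp_id])
  obtain ⟨e, he⟩ : ∃ e : C₀ ⟶ P', h₁ = e ≫ p' := Triangle.coyoneda_exact₃ _ hP' h₁ (by
    change h₁ ≫ h₂ ≫ (-(f ≫ p)⟦(1 : ℤ)⟧') = 0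
    rw [← Category.assoc, ← hh, Preadditive.comp_neg, Functor.map_comp, ← Category.assoc, hhf,
      zero_comp, neg_zero])
  obtain ⟨w, hw⟩ : ∃ w : C₀ ⟶ M, c - e ≫ π = w ≫ m := Triangle.coyoneda_exact₃ _ hP _ (by
    change (c - e ≫ π) ≫ k = 0
    rw [Preadditive.sub_comp, Category.assoc, ← hπ', ← hck, ← Category.assoc, ← he, ← hh,
      CategoryTheory.Functor.map_id, Category.comp_id, sub_self])
  have hcN : FactorsThru N c := by
    rw [sub_eq_iff_eq_add.1 hw]
    exact ((FactorsThru.of_mem hM m).precomp w).add hNext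
      ((FactorsThru.of_mem (hNext _ hP' hM hN₂) π).precomp e)
  rw [sub_eq_iff_eq_add.1 ht]
  exact (FactorsThru.postcomp ⟨N₂, hN₂, h₁, h₂, hh⟩ t).add hNext (hcN.postcomp l)

lemma of_cone_mem {B' C' N₂ M : C} (hN₂ : N₂ ∈ N) (hM : M ∈ N) {s : B' ⟶ C'} {k : C' ⟶ N₂}
    (w : N₂ ⟶ M⟦(1 : ℤ)⟧) (t : M ⟶ B')
    (hT : Triangle.mk s k (w ≫ t⟦(1 : ℤ)⟧') ∈ distTriang C) : SN N s := by
  have h : FactorsThru N (descShift (w ≫ t⟦(1 : ℤ)⟧')) := by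
    refine ⟨M, hM, descShift w, t, ?_⟩
    unfold descShift
    rw [Functor.map_comp]
    exact (Category.assoc _ _ _).trans ((congrArg (w⟦(-1 : ℤ)⟧' ≫ ·)
      ((shiftEquiv C (1 : ℤ)).unitIso.inv.naturality t)).trans (Category.assoc _ _ _).symm)
  exact ⟨_, _, _, inv_rot_of_distTriang _ hT, h.neg, (FactorsThru.of_mem_tgt hN₂ k).postcomp _⟩

open ZeroObject in
lemma zero_of_mem (hN0 : ∀ X : C, Limits.IsZero X → X ∈ N) {A : C} (hA : A ∈ N) :
    SN N (0 : 0 ⟶ A) :=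
  ⟨_, _, _, inv_rot_of_distTriang _ (contractible_distinguished₁ A),
    FactorsThru.of_mem_tgt (hN0 _ (isZero_zero C)) _, FactorsThru.of_mem hA _⟩

/-- The left Ore condition for `S_N` modulo the ideal of morphisms that factor through `N`. -/
lemma exists_ore
    (hNsum : ∀ ⦃X Z : C⦄ (i : X ⟶ Z) (r : Z ⟶ X), i ≫ r = 𝟙 X → Z ∈ N → X ∈ N)
    (hNext : ∀ (T : Triangle C), (T ∈ distTriang C) → T.obj₁ ∈ N → T.obj₃ ∈ N → T.obj₂ ∈ N)
    {B C₀ B' : C} {s : B ⟶ C₀} (hs : SN N s) (φ : B ⟶ B') :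
    ∃ (C' : C) (s' : B' ⟶ C') (φ' : C₀ ⟶ C'), SN N s' ∧ FactorsThru N (φ ≫ s' - s ≫ φ') := by
  obtain ⟨A, f, h, hT, ⟨N₁, hN₁, f₁, f₂, hf⟩, ⟨N₂, hN₂, h₁, h₂, hh⟩⟩ := hs
  obtain ⟨E, ι, π, hE⟩ := distinguished_cocone_triangle₂ h₂
  obtain ⟨e, hι, -⟩ : ∃ e : B ⟶ E, f ≫ e = 𝟙 A ≫ ι ∧ s ≫ h₁ = e ≫ π :=
    complete_distinguished_triangle_morphism₂ _ _ hT hE (𝟙 A) h₁ (by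
      change h ≫ (𝟙 A)⟦(1 : ℤ)⟧' = h₁ ≫ h₂
      rw [CategoryTheory.Functor.map_id, Category.comp_id, hh])
  rw [Category.id_comp] at hι
  have hEN : E ∈ N := by
    have hπ : SN N π := ⟨A, ι, h₂, hE,
      hι ▸ FactorsThru.postcomp ⟨N₁, hN₁, f₁, f₂, hf⟩ e, FactorsThru.of_mem hN₂ h₂⟩
    obtain ⟨Z, hZ, i, r, hir⟩ := hπ.factorsThru_of_comp_right hNext (x := 𝟙 E)
      (FactorsThru.of_mem_tgt hN₂ _)
    exact hNsum i r hir.symm hZ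
  obtain ⟨C', s', k, hC'⟩ := distinguished_cocone_triangle₂
    ((h₂ ≫ f₁⟦(1 : ℤ)⟧') ≫ (f₂ ≫ φ)⟦(1 : ℤ)⟧')
  have hzero : ((h₂ ≫ f₁⟦(1 : ℤ)⟧') ≫ (f₂ ≫ φ)⟦(1 : ℤ)⟧') ≫ s'⟦(1 : ℤ)⟧' = 0 :=
    comp_distTriang_mor_zero₃₁ _ hC'
  obtain ⟨e', he'⟩ : ∃ e' : E ⟶ C', ι ≫ e' = f ≫ φ ≫ s' :=
    exists_extension _ hE (f ≫ φ ≫ s') (by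
      change h₂ ≫ (f ≫ φ ≫ s')⟦(1 : ℤ)⟧' = 0
      rw [← hzero, hf]
      simp only [Functor.map_comp, Category.assoc])
  obtain ⟨φ', hφ'⟩ : ∃ φ' : C₀ ⟶ C', φ ≫ s' - e ≫ e' = s ≫ φ' :=
    Triangle.yoneda_exact₂ _ hT _ (by
      change f ≫ (φ ≫ s' - e ≫ e') = 0
      rw [Preadditive.comp_sub, ← Category.assoc f e, hι, he', sub_self])
  refine ⟨C', s', φ', of_cone_mem hN₂ hN₁ _ _ hC', ?_⟩
  rw [← hφ', sub_sub_cancel]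
  exact (FactorsThru.of_mem hEN e').precomp e

end SN

/-- Two morphisms are related when their difference factors through `N`. -/
def idealRel (N : Set C) : HomRel C := fun _ _ f g ↦ FactorsThru N (f - g)

lemma idealRel_congruence {N : Set C} (hN0 : ∀ X : C, Limits.IsZero X → X ∈ N)
    (hNext : ∀ (T : Triangle C), (T ∈ distTriang C) → T.obj₁ ∈ N → T.obj₃ ∈ N → T.obj₂ ∈ N) :
    Congruence (idealRel N) where
  equivalence :=
    { refl := fun f ↦ by simpa [idealRel] using FactorsThru.zero hN0
      symm := fun {f g} h ↦ by simpa [idealRel] using FactorsThru.neg h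
      trans := fun {f g k} h h' ↦ by simpa [idealRel] using FactorsThru.add hNext h h' }
  comp_left f _ _ h := by simpa [idealRel] using FactorsThru.precomp h f
  comp_right g h := by simpa [idealRel] using FactorsThru.postcomp h g

/-- The image of `S_N` in the ideal quotient of `C` by `N`. -/
def SNImage (N : Set C) : MorphismProperty (Quotient (idealRel N)) :=
  fun X Y f ↦ ∃ s : X.as ⟶ Y.as, SN N s ∧ (Quotient.functor (idealRel N)).map s = f

/-- The multiplicative closure of the image of `S_N` in the ideal quotient of `C` by `N`. -/
abbrev SNQuotient (N : Set C) : MorphismProperty (Quotient (idealRel N)) :=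
  (SNImage N).multiplicativeClosure

namespace SNQuotient

variable {N : Set C}

lemma mono_map (hN0 : ∀ X : C, Limits.IsZero X → X ∈ N)
    (hNext : ∀ (T : Triangle C), (T ∈ distTriang C) → T.obj₁ ∈ N → T.obj₃ ∈ N → T.obj₂ ∈ N)
    {X Y : C} {s : X ⟶ Y} (hs : SN N s) : Mono ((Quotient.functor (idealRel N)).map s) := by
  have := idealRel_congruence hN0 hNext
  refine ⟨fun {W} a b hab ↦ ?_⟩
  obtain ⟨a, rfl⟩ := (Quotient.functor (idealRel N)).map_surjective (X := W.as) (Y := X) a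
  obtain ⟨b, rfl⟩ := (Quotient.functor (idealRel N)).map_surjective (X := W.as) (Y := X) b
  have hab' : (Quotient.functor (idealRel N)).map (a ≫ s) =
    (Quotient.functor (idealRel N)).map (b ≫ s) := by simpa only [Functor.map_comp] using hab
  rw [Quotient.functor_map_eq_iff] at hab'
  refine CategoryTheory.Quotient.sound _ (hs.factorsThru_of_comp_right hNext ?_)
  rwa [Preadditive.sub_comp]

lemma epi_map (hN0 : ∀ X : C, Limits.IsZero X → X ∈ N)
    (hNext : ∀ (T : Triangle C), (T ∈ distTriang C) → T.obj₁ ∈ N → T.obj₃ ∈ N → T.obj₂ ∈ N)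
    {X Y : C} {s : X ⟶ Y} (hs : SN N s) : Epi ((Quotient.functor (idealRel N)).map s) := by
  have := idealRel_congruence hN0 hNext
  refine ⟨fun {W} a b hab ↦ ?_⟩
  obtain ⟨a, rfl⟩ := (Quotient.functor (idealRel N)).map_surjective (X := Y) (Y := W.as) a
  obtain ⟨b, rfl⟩ := (Quotient.functor (idealRel N)).map_surjective (X := Y) (Y := W.as) b
  have hab' : (Quotient.functor (idealRel N)).map (s ≫ a) =
    (Quotient.functor (idealRel N)).map (s ≫ b) := by simpa only [Functor.map_comp] using hab
  rw [Quotient.functor_map_eq_iff] at hab'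
  refine CategoryTheory.Quotient.sound _ (hs.factorsThru_of_comp_left hNext ?_)
  rwa [Preadditive.comp_sub]

lemma mono (hN0 : ∀ X : C, Limits.IsZero X → X ∈ N)
    (hNext : ∀ (T : Triangle C), (T ∈ distTriang C) → T.obj₁ ∈ N → T.obj₃ ∈ N → T.obj₂ ∈ N)
    {X Y : Quotient (idealRel N)} {s : X ⟶ Y} (hs : SNQuotient N s) : Mono s := by
  induction hs with
  | of _ hf =>
    obtain ⟨s, hs, rfl⟩ := hf
    exact mono_map hN0 hNext hs
  | id => infer_instance
  | comp_of f g _ hg hf =>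
    obtain ⟨s, hs, rfl⟩ := hg
    have := mono_map hN0 hNext hs
    exact mono_comp f _

lemma epi (hN0 : ∀ X : C, Limits.IsZero X → X ∈ N)
    (hNext : ∀ (T : Triangle C), (T ∈ distTriang C) → T.obj₁ ∈ N → T.obj₃ ∈ N → T.obj₂ ∈ N)
    {X Y : Quotient (idealRel N)} {s : X ⟶ Y} (hs : SNQuotient N s) : Epi s := by
  induction hs with
  | of _ hf =>
    obtain ⟨s, hs, rfl⟩ := hf
    exact epi_map hN0 hNext hs
  | id => infer_instance
  | comp_of f g _ hg hf =>
    obtain ⟨s, hs, rfl⟩ := hg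
    have := epi_map hN0 hNext hs
    exact epi_comp f _

lemma map_mem {X Y : C} {s : X ⟶ Y} (hs : SN N s) :
    SNQuotient N ((Quotient.functor (idealRel N)).map s) :=
  .of _ ⟨s, hs, rfl⟩

lemma exists_ore_map
    (hNsum : ∀ ⦃X Z : C⦄ (i : X ⟶ Z) (r : Z ⟶ X), i ≫ r = 𝟙 X → Z ∈ N → X ∈ N)
    (hNext : ∀ (T : Triangle C), (T ∈ distTriang C) → T.obj₁ ∈ N → T.obj₃ ∈ N → T.obj₂ ∈ N)
    {X X' : C} {Y : Quotient (idealRel N)} {s : X ⟶ X'} (hs : SN N s)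
    (φ : (Quotient.functor (idealRel N)).obj X ⟶ Y) :
    ∃ (Y' : Quotient (idealRel N)) (s' : Y ⟶ Y')
      (φ' : (Quotient.functor (idealRel N)).obj X' ⟶ Y'),
      SNQuotient N s' ∧ φ ≫ s' = (Quotient.functor (idealRel N)).map s ≫ φ' := by
  obtain ⟨φ, rfl⟩ := (Quotient.functor (idealRel N)).map_surjective (X := X) (Y := Y.as) φ
  obtain ⟨Y', s', φ', hs', h⟩ := hs.exists_ore hNsum hNext φ
  refine ⟨_, _, (Quotient.functor (idealRel N)).map φ', map_mem hs', ?_⟩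
  exact CategoryTheory.Quotient.sound (idealRel N) h

lemma exists_ore
    (hNsum : ∀ ⦃X Z : C⦄ (i : X ⟶ Z) (r : Z ⟶ X), i ≫ r = 𝟙 X → Z ∈ N → X ∈ N)
    (hNext : ∀ (T : Triangle C), (T ∈ distTriang C) → T.obj₁ ∈ N → T.obj₃ ∈ N → T.obj₂ ∈ N)
    {X X' : Quotient (idealRel N)} {s : X ⟶ X'} (hs : SNQuotient N s) :
    ∀ {Y : Quotient (idealRel N)} (φ : X ⟶ Y),
      ∃ (Y' : Quotient (idealRel N)) (s' : Y ⟶ Y') (φ' : X' ⟶ Y'),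
        SNQuotient N s' ∧ φ ≫ s' = s ≫ φ' := by
  induction hs with
  | of _ hf =>
    obtain ⟨s, hs, rfl⟩ := hf
    exact exists_ore_map hNsum hNext hs
  | id => exact fun {Y} φ ↦ ⟨Y, 𝟙 Y, φ, .id Y, by simp⟩
  | comp_of f g _ hg hf =>
    intro Y φ
    obtain ⟨s, hs, rfl⟩ := hg
    obtain ⟨Y', s', φ', hs', h⟩ := hf φ
    obtain ⟨Y'', s'', φ'', hs'', h'⟩ := exists_ore_map hNsum hNext hs φ'
    refine ⟨Y'', s' ≫ s'', φ'', (SNQuotient N).comp_mem _ _ hs' hs'', ?_⟩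
    rw [← Category.assoc, h, Category.assoc, Category.assoc]
    exact congrArg (f ≫ ·) h'

lemma hasLeftCalculusOfFractions (hN0 : ∀ X : C, Limits.IsZero X → X ∈ N)
    (hNsum : ∀ ⦃X Z : C⦄ (i : X ⟶ Z) (r : Z ⟶ X), i ≫ r = 𝟙 X → Z ∈ N → X ∈ N)
    (hNext : ∀ (T : Triangle C), (T ∈ distTriang C) → T.obj₁ ∈ N → T.obj₃ ∈ N → T.obj₂ ∈ N) :
    (SNQuotient N).HasLeftCalculusOfFractions where
  exists_leftFraction _ _ φ := by
    obtain ⟨Y', s', φ', hs', h⟩ := exists_ore hNsum hNext φ.hs φ.f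
    exact ⟨⟨φ', s', hs'⟩, h⟩
  ext _ _ Y f₁ f₂ s hs h := by
    have := epi hN0 hNext hs
    exact ⟨Y, 𝟙 Y, .id Y, by rw [(cancel_epi s).1 h]⟩

end SNQuotient

theorem stmt9 (N : Set C)
    (hN0 : ∀ X : C, Limits.IsZero X → X ∈ N)
    (hNiso : ∀ ⦃X Y : C⦄, (X ≅ Y) → X ∈ N → Y ∈ N)
    (hNsum : ∀ ⦃X Z : C⦄ (i : X ⟶ Z) (r : Z ⟶ X), i ≫ r = 𝟙 X → Z ∈ N → X ∈ N)
    (hNext : ∀ (T : Triangle C), (T ∈ distTriang C) → T.obj₁ ∈ N → T.obj₃ ∈ N → T.obj₂ ∈ N)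
    {D : Type u₂} [Category.{v₂} D] [Preadditive D] [HasZeroObject D]
    (Q : C ⥤ D) [Q.Additive] [Q.IsLocalization (SNProp N)]
    (A : C) :
    Limits.IsZero (Q.obj A) ↔ A ∈ N := by
  constructor
  · intro hA
    have := idealRel_congruence hN0 hNext
    have := SNQuotient.hasLeftCalculusOfFractions hN0 hNsum hNext
    have hF : (SNProp N).IsInvertedBy (Quotient.functor (idealRel N) ⋙ (SNQuotient N).Q) :=
      fun _ _ _ hs ↦ Localization.inverts (SNQuotient N).Q (SNQuotient N) _
        (SNQuotient.map_mem hs)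
    have hmap : (Quotient.functor (idealRel N) ⋙ (SNQuotient N).Q).map (𝟙 A) =
        (Quotient.functor (idealRel N) ⋙ (SNQuotient N).Q).map 0 := by
      rw [← NatIso.naturality_1 (Localization.fac _ hF Q),
        ← NatIso.naturality_1 (Localization.fac _ hF Q), Functor.comp_map, Functor.comp_map,
        hA.eq_of_src (Q.map (𝟙 A)) (Q.map 0)]
    obtain ⟨Z, s, hs, h⟩ := (MorphismProperty.map_eq_iff_postcomp (SNQuotient N).Q
      (SNQuotient N) _ _).1 hmap
    have := SNQuotient.mono hN0 hNext hs
    rw [cancel_mono, Quotient.functor_map_eq_iff] at h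
    obtain ⟨Z, hZ, i, r, hir⟩ := h
    exact hNsum i r (by rw [← hir, sub_zero]) hZ
  · intro hA
    have := Localization.inverts Q (SNProp N) _ (SN.zero_of_mem hN0 hA)
    exact (Q.map_isZero (isZero_zero C)).of_iso (asIso (Q.map (0 : _ ⟶ A))).symm
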